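/- Let n ≥ 2, 1 ≤ m ≤ n, and B > 0. Let Ψ : ℝ^m → ℝ be continuous and ℤ^m-periodic with Ψ ≤ 0 on ℝ^m, Ψ(0) = 0, and Ψ(y) ≥ −B|y|² for all |y| ≤ 1/2, and define the laminar obstacle ψ : ℝⁿ → ℝ by ψ(x) := Ψ(x₁, …, x_m). Then there exists a constant C > 0 depending only on n, m and B such that for every μ ∈ (0,1] and every continuous ℤⁿ-periodic function v : ℝⁿ → ℝ satisfying v ≥ ψ on ℝⁿ and Δv ≤ μ weakly in ℝⁿ, one has for all x ∈ ℝⁿ: v(x) ≥ −Cμ if m = 1; v(x) ≥ −Cμ(1 + |log μ|) if m = 2; and v(x) ≥ −Cμ^{2/m} if 3 ≤ m ≤ n. In particular the height 𝓔(μ) of the minimal such supersolution obeys the corresponding bound. -/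

import Mathlib

open MeasureTheory Metric Set

/-- The (pointwise) Laplacian of a smooth `f : ℝⁿ → ℝ`. -/
noncomputable def lapl (n : ℕ) (f : EuclideanSpace ℝ (Fin n) → ℝ)
    (x : EuclideanSpace ℝ (Fin n)) : ℝ :=
  ∑ i : Fin n, fderiv ℝ (fun y => fderiv ℝ f y (EuclideanSpace.single i 1)) x
    (EuclideanSpace.single i 1)

/-- `f : ℝⁿ → ℝ` is `ℤⁿ`-periodic. -/
def IsZnPeriodic (n : ℕ) (f : EuclideanSpace ℝ (Fin n) → ℝ) : Prop :=
  ∀ (x : EuclideanSpace ℝ (Fin n)) (k : Fin n → ℤ),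
    f (x + (WithLp.equiv 2 (Fin n → ℝ)).symm (fun i => (k i : ℝ))) = f x

/-- `Δw ≤ c` weakly in `V`. -/
def LapLeWeak (n : ℕ) (V : Set (EuclideanSpace ℝ (Fin n)))
    (w : EuclideanSpace ℝ (Fin n) → ℝ) (c : ℝ) : Prop :=
  ∀ φ : EuclideanSpace ℝ (Fin n) → ℝ, ContDiff ℝ (⊤ : ℕ∞) φ → HasCompactSupport φ →
    tsupport φ ⊆ V → (∀ x, 0 ≤ φ x) →
    ∫ x in V, w x * lapl n φ x ≤ c * ∫ x in V, φ x

/-- The laminar obstacle `ψ(x) = Ψ(x₁, …, x_m)` on `ℝⁿ` built from `Ψ : ℝ^m → ℝ`. -/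
noncomputable def laminar (n m : ℕ) (h : m ≤ n) (Ψ : EuclideanSpace ℝ (Fin m) → ℝ)
    (x : EuclideanSpace ℝ (Fin n)) : ℝ :=
  Ψ ((WithLp.equiv 2 (Fin m → ℝ)).symm (fun j => x (Fin.castLE h j)))

open scoped Convolution

/-- Reduction of a point modulo `ℤⁿ` to the centred unit cube. -/
noncomputable def cubeReduce (n : ℕ) (x : EuclideanSpace ℝ (Fin n)) : EuclideanSpace ℝ (Fin n) :=
  x + (WithLp.equiv 2 (Fin n → ℝ)).symm (fun i => ((-round (x i) : ℤ) : ℝ))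

theorem cubeReduce_apply {n : ℕ} (x : EuclideanSpace ℝ (Fin n)) (i : Fin n) :
    cubeReduce n x i = x i - round (x i) := by
  simp [cubeReduce, sub_eq_add_neg]

theorem abs_cubeReduce_le_half {n : ℕ} (x : EuclideanSpace ℝ (Fin n)) (i : Fin n) :
    |cubeReduce n x i| ≤ 1 / 2 := by
  rw [cubeReduce_apply]
  exact abs_sub_round _

theorem abs_cubeReduce_le_abs {n : ℕ} (x : EuclideanSpace ℝ (Fin n)) (i : Fin n) :
    |cubeReduce n x i| ≤ |x i| := by
  rw [cubeReduce_apply]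
  simpa using round_le (x i) 0

theorem IsZnPeriodic.apply_cubeReduce {n : ℕ} {f : EuclideanSpace ℝ (Fin n) → ℝ}
    (hf : IsZnPeriodic n f) (x : EuclideanSpace ℝ (Fin n)) : f (cubeReduce n x) = f x :=
  hf x _

/-- The centred closed unit cube in `ℝⁿ`. -/
def centredCube (n : ℕ) : Set (EuclideanSpace ℝ (Fin n)) := {x | ∀ i, |x i| ≤ 1 / 2}

theorem isCompact_centredCube (n : ℕ) : IsCompact (centredCube n) := by
  have h : IsCompact (Set.pi univ fun _ : Fin n => Icc (-(1 / 2) : ℝ) (1 / 2)) :=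
    isCompact_univ_pi fun _ => isCompact_Icc
  have h2 := h.image (PiLp.continuous_toLp 2 (fun _ : Fin n => ℝ))
  refine h2.of_isClosed_subset ?_ ?_
  · simp only [centredCube, ofPred_forall]
    exact isClosed_iInter fun i => isClosed_le (by fun_prop) continuous_const
  · intro x hx
    exact ⟨x.ofLp, fun i _ => abs_le.1 (hx i), rfl⟩

/-- The squared length of the first `m` coordinates. -/
def headSq {n : ℕ} (m : ℕ) (x : EuclideanSpace ℝ (Fin n)) : ℝ :=
  ∑ i : Fin n, if (i : ℕ) < m then x i ^ 2 else 0

theorem continuous_headSq {n : ℕ} (m : ℕ) :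
    Continuous (headSq m : EuclideanSpace ℝ (Fin n) → ℝ) := by
  unfold headSq
  refine continuous_finsetSum _ fun i _ => ?_
  split_ifs <;> fun_prop

theorem sum_ite_val_lt {n m : ℕ} (h : m ≤ n) (f : Fin n → ℝ) :
    (∑ i : Fin n, if (i : ℕ) < m then f i else 0) = ∑ j : Fin m, f (Fin.castLE h j) := by
  obtain ⟨k, rfl⟩ := Nat.exists_eq_add_of_le h
  rw [Fin.sum_univ_add]
  simp
  rfl

theorem headSq_cubeReduce_le {n : ℕ} (m : ℕ) (x : EuclideanSpace ℝ (Fin n)) :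
    headSq m (cubeReduce n x) ≤ headSq m x := by
  refine Finset.sum_le_sum fun i _ => ?_
  split_ifs
  · exact sq_le_sq.2 (abs_cubeReduce_le_abs x i)
  · exact le_rfl

theorem headSq_le_of_mem_centredCube {n m : ℕ} (h : m ≤ n) {x : EuclideanSpace ℝ (Fin n)}
    (hx : x ∈ centredCube n) : headSq m x ≤ m / 4 := by
  rw [headSq, sum_ite_val_lt h]
  calc _ ≤ ∑ _j : Fin m, (1 / 4 : ℝ) := Finset.sum_le_sum fun j _ => by
        have := sq_le_sq' (abs_le.1 (hx (Fin.castLE h j))).1 (abs_le.1 (hx (Fin.castLE h j))).2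
        linarith
    _ = m / 4 := by simp; ring

theorem headSq_add_smul_single {n : ℕ} (m : ℕ) (x : EuclideanSpace ℝ (Fin n)) (i : Fin n) (t : ℝ) :
    headSq m (x + t • EuclideanSpace.single i 1) =
      headSq m x + if (i : ℕ) < m then 2 * x i * t + t ^ 2 else 0 := by
  have h : ∀ j : Fin n, (if (j : ℕ) < m then (x + t • EuclideanSpace.single i (1 : ℝ)) j ^ 2 else 0)
      = (if (j : ℕ) < m then x j ^ 2 else 0) +
        if i = j then (if (i : ℕ) < m then 2 * x i * t + t ^ 2 else 0) else 0 := by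
    intro j
    by_cases hij : i = j
    · subst hij
      by_cases him : (i : ℕ) < m
      · simp [him]
        ring
      · simp [him]
    · have : j ≠ i := fun e => hij e.symm
      simp [hij, this]
  simp only [headSq, h, Finset.sum_add_distrib, Finset.sum_ite_eq, Finset.mem_univ, if_true]

theorem IsLocalMin.deriv_deriv_nonneg {f : ℝ → ℝ} {a : ℝ} (h : IsLocalMin f a)
    (hc : ContinuousAt f a) : 0 ≤ deriv (deriv f) a := by
  by_contra! hneg
  have hmax := isLocalMax_of_deriv_deriv_neg hneg h.deriv_eq_zero hc
  have hconst : f =ᶠ[nhds a] fun _ => f a := by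
    filter_upwards [h, hmax] with x h1 h2 using le_antisymm h2 h1
  have := hconst.deriv.deriv_eq
  simp at this
  linarith

theorem IsLocalMin.nonneg_of_hasDerivAt {f f' : ℝ → ℝ} {a c : ℝ} (h : IsLocalMin f a)
    (hf : ∀ᶠ t in nhds a, HasDerivAt f (f' t) t) (hf' : HasDerivAt f' c a) : 0 ≤ c := by
  have h1 : deriv f =ᶠ[nhds a] f' := hf.mono fun t ht => ht.deriv
  have h2 := h.deriv_deriv_nonneg hf.self_of_nhds.continuousAt
  rwa [h1.deriv_eq, hf'.deriv] at h2

/-- At a local minimum of `w - μ H(|x'|²)` the Laplacian of `w` is at least that of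
`μ H(|x'|²)`. -/
theorem le_lapl_of_isLocalMin_sub {n m : ℕ} {w : EuclideanSpace ℝ (Fin n) → ℝ} (hw : ContDiff ℝ 2 w)
    {H H' H'' : ℝ → ℝ} {μ : ℝ} {x : EuclideanSpace ℝ (Fin n)}
    (hH : ∀ᶠ t in nhds (headSq m x), HasDerivAt H (H' t) t)
    (hH' : HasDerivAt H' (H'' (headSq m x)) (headSq m x)) (hmn : m ≤ n)
    (hmin : IsLocalMin (fun y => w y - μ * H (headSq m y)) x) :
    μ * (4 * headSq m x * H'' (headSq m x) + 2 * m * H' (headSq m x)) ≤ lapl n w x := by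
  set q := headSq m x with hq
  have key : ∀ i : Fin n, (if (i : ℕ) < m then
      μ * (H'' q * (2 * x i) ^ 2 + 2 * H' q) else 0) ≤
      fderiv ℝ (fun y => fderiv ℝ w y (EuclideanSpace.single i 1)) x
        (EuclideanSpace.single i 1) := by
    intro i
    set e : EuclideanSpace ℝ (Fin n) := EuclideanSpace.single i 1
    have hline : ∀ t : ℝ, HasDerivAt (fun t : ℝ => x + t • e) e t := fun t => by
      simpa using ((hasDerivAt_id t).smul_const e).const_add x
    have hcont : Filter.Tendsto (fun t : ℝ => x + t • e) (nhds 0) (nhds x) := by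
      have := (hline 0).continuousAt.tendsto
      simpa using this
    have hw1 : ∀ t : ℝ, HasDerivAt (fun t : ℝ => w (x + t • e)) (fderiv ℝ w (x + t • e) e) t :=
      fun t => ((hw.differentiable (by norm_num)) _).hasFDerivAt.comp_hasDerivAt t (hline t)
    have hw2 : HasDerivAt (fun t : ℝ => fderiv ℝ w (x + t • e) e)
        (fderiv ℝ (fun y => fderiv ℝ w y e) x e) 0 := by
      have hd : Differentiable ℝ (fun y => fderiv ℝ w y e) :=
        ((hw.fderiv_right (m := 1) (by norm_num)).clm_apply contDiff_const).differentiable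
          (by norm_num)
      have := (hd (x + (0 : ℝ) • e)).hasFDerivAt.comp_hasDerivAt 0 (hline 0)
      rwa [zero_smul, add_zero] at this
    have hmin0 : IsLocalMin (fun t : ℝ => w (x + t • e) - μ * H (headSq m (x + t • e))) 0 := by
      have := hcont.eventually hmin
      simpa [IsLocalMin, IsMinFilter] using this
    by_cases him : (i : ℕ) < m
    · have hP : ∀ t : ℝ, headSq m (x + t • e) = q + (2 * x i * t + t ^ 2) := fun t => by
        rw [headSq_add_smul_single, if_pos him]
      simp only [hP] at hmin0
      have hpoly : ∀ t : ℝ, HasDerivAt (fun t : ℝ => q + (2 * x i * t + t ^ 2))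
          (2 * x i + 2 * t) t := fun t => by
        have := (((hasDerivAt_id t).const_mul (2 * x i)).add ((hasDerivAt_id t).pow 2)).const_add q
        simpa using this
      have hpc : Filter.Tendsto (fun t : ℝ => q + (2 * x i * t + t ^ 2)) (nhds 0) (nhds q) := by
        have := (hpoly 0).continuousAt.tendsto
        simpa using this
      have h1 : ∀ᶠ t in nhds (0 : ℝ), HasDerivAt
          (fun t : ℝ => w (x + t • e) - μ * H (q + (2 * x i * t + t ^ 2)))
          (fderiv ℝ w (x + t • e) e - μ * (H' (q + (2 * x i * t + t ^ 2)) * (2 * x i + 2 * t)))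
          t := by
        filter_upwards [hpc.eventually hH] with t ht
        exact (hw1 t).sub ((ht.comp t (hpoly t)).const_mul μ)
      have hH'0 : HasDerivAt (fun t : ℝ => H' (q + (2 * x i * t + t ^ 2)))
          (H'' q * (2 * x i)) 0 := by
        have := HasDerivAt.comp (0 : ℝ) (h₂ := H') (h₂' := H'' q) (by simpa using hH') (hpoly 0)
        rwa [mul_zero, add_zero] at this
      have hlin : HasDerivAt (fun t : ℝ => 2 * x i + 2 * t) 2 0 := by
        simpa using ((hasDerivAt_id (0 : ℝ)).const_mul 2).const_add (2 * x i)
      have h2 := hw2.sub ((hH'0.mul hlin).const_mul μ)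
      have h3 := hmin0.nonneg_of_hasDerivAt h1 h2
      rw [if_pos him]
      simp only [mul_zero, add_zero, ne_eq, OfNat.ofNat_ne_zero, not_false_eq_true, zero_pow] at h3
      linarith
    · have hP : ∀ t : ℝ, headSq m (x + t • e) = q := fun t => by
        rw [headSq_add_smul_single, if_neg him, add_zero]
      simp only [hP] at hmin0
      rw [if_neg him]
      exact hmin0.nonneg_of_hasDerivAt (.of_forall fun t => (hw1 t).sub_const _) hw2
  have hsum := Finset.sum_le_sum fun i (_ : i ∈ Finset.univ) => key i
  refine le_trans (le_of_eq ?_) hsum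
  rw [sum_ite_val_lt hmn, ← Finset.mul_sum, Finset.sum_add_distrib, ← Finset.mul_sum]
  have : ∑ j : Fin m, (2 * x (Fin.castLE hmn j)) ^ 2 = 4 * q := by
    rw [hq, headSq, sum_ite_val_lt hmn, Finset.mul_sum]
    exact Finset.sum_congr rfl fun j _ => by ring
  rw [this, Finset.sum_const, Finset.card_univ, Fintype.card_fin, nsmul_eq_mul]
  ring

/-- Comparison of a smooth periodic supersolution with a radial barrier in the first `m`
coordinates. -/
theorem barrier_le_of_lapl_le {n m : ℕ} (hm : 1 ≤ m) (hmn : m ≤ n)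
    {w : EuclideanSpace ℝ (Fin n) → ℝ} (hw : ContDiff ℝ 2 w) (hper : IsZnPeriodic n w)
    {μ : ℝ} (hμ : 0 < μ) (hlap : ∀ x, lapl n w x ≤ μ) {H H' H'' : ℝ → ℝ}
    (hH : ∀ t, 0 < t → HasDerivAt H (H' t) t) (hH' : ∀ t, 0 < t → HasDerivAt H' (H'' t) t)
    (hsub : ∀ t, 0 < t → 1 < 4 * t * H'' t + 2 * m * H' t)
    (hanti : AntitoneOn H (Ioc 0 (m : ℝ))) {s : ℝ} (hs : 0 < s) (hs4 : s ≤ 1 / 4) {L : ℝ}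
    (hL : ∀ x ∈ centredCube n, headSq m x ≤ s → -L ≤ w x) (x : EuclideanSpace ℝ (Fin n)) :
    -L - μ * (H s - H m) ≤ w x := by
  have hm1 : (1 : ℝ) ≤ m := by exact_mod_cast hm
  have hHc : Continuous fun y : EuclideanSpace ℝ (Fin n) => H (max (headSq m y) s) := by
    refine continuous_iff_continuousAt.2 fun y => ?_
    exact ContinuousAt.comp (f := fun y => max (headSq m y) s)
      (hH _ (lt_max_of_lt_right hs)).continuousAt
      ((continuous_headSq m).max continuous_const).continuousAt
  obtain ⟨x₀, hx₀, hmin⟩ := (isCompact_centredCube n).exists_isMinOn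
    ⟨0, fun i => by simp⟩ (hw.continuous.sub (continuous_const.mul hHc) :
      Continuous fun y => w y - μ * H (max (headSq m y) s)).continuousOn
  have hq₀ := headSq_le_of_mem_centredCube hmn hx₀
  have hglob : ∀ y, headSq m y ≤ m →
      w x₀ - μ * H (max (headSq m x₀) s) ≤ w y - μ * H (max (headSq m y) s) := by
    intro y hy
    have h1 := hmin (show cubeReduce n y ∈ centredCube n from abs_cubeReduce_le_half y)
    simp only [mem_ofPred_eq, Pi.sub_apply, hper.apply_cubeReduce] at h1
    have hle := headSq_cubeReduce_le m y
    have h2 : H (max (headSq m y) s) ≤ H (max (headSq m (cubeReduce n y)) s) :=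
      hanti ⟨lt_max_of_lt_right hs, max_le (hle.trans hy) (by linarith)⟩
        ⟨lt_max_of_lt_right hs, max_le hy (by linarith)⟩ (max_le_max_right s hle)
    have := mul_le_mul_of_nonneg_left h2 hμ.le
    linarith
  have hx₀s : headSq m x₀ ≤ s := by
    by_contra! hlt
    have hq : 0 < headSq m x₀ := hs.trans hlt
    have hloc : IsLocalMin (fun y => w y - μ * H (headSq m y)) x₀ := by
      have hc := (continuous_headSq m).continuousAt (x := x₀)
      filter_upwards [hc.eventually_lt_const (show headSq m x₀ < m by linarith),
        hc.eventually_const_lt hlt] with y hy1 hy2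
      have := hglob y hy1.le
      rwa [max_eq_left hlt.le, max_eq_left hy2.le] at this
    have h1 := le_lapl_of_isLocalMin_sub (H'' := H'') hw
      ((lt_mem_nhds hq).mono fun t ht => hH t ht) (hH' _ hq) hmn hloc
    have h2 := mul_lt_mul_of_pos_left (hsub _ hq) hμ
    linarith [hlap x₀]
  have h1 := hglob (cubeReduce n x) <|
    (headSq_le_of_mem_centredCube hmn (abs_cubeReduce_le_half x)).trans (by linarith)
  rw [hper.apply_cubeReduce, max_eq_right hx₀s] at h1
  have h2 : H m ≤ H (max (headSq m (cubeReduce n x)) s) := by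
    have hle : max (headSq m (cubeReduce n x)) s ≤ m :=
      max_le ((headSq_le_of_mem_centredCube hmn (abs_cubeReduce_le_half x)).trans (by linarith))
        (by linarith)
    exact hanti ⟨lt_max_of_lt_right hs, hle⟩ ⟨by linarith, le_rfl⟩ hle
  have := mul_le_mul_of_nonneg_left h2 hμ.le
  linarith [hL x₀ hx₀ hx₀s]

section Mollification

variable {n : ℕ}

theorem fderiv_comp_const_sub_apply {f : EuclideanSpace ℝ (Fin n) → ℝ} (hf : Differentiable ℝ f)
    (x y e : EuclideanSpace ℝ (Fin n)) :
    fderiv ℝ (fun y => f (x - y)) y e = -fderiv ℝ f (x - y) e := by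
  have h : HasFDerivAt (fun y => x - y) (-ContinuousLinearMap.id ℝ (EuclideanSpace ℝ (Fin n))) y :=
    (hasFDerivAt_id y).const_sub x
  have := ((hf (x - y)).hasFDerivAt.comp y h).fderiv
  simp only [Function.comp_def] at this
  rw [this]
  simp

theorem contDiff_fderiv_apply {f : EuclideanSpace ℝ (Fin n) → ℝ} (hf : ContDiff ℝ (⊤ : ℕ∞) f)
    (e : EuclideanSpace ℝ (Fin n)) : ContDiff ℝ (⊤ : ℕ∞) fun y => fderiv ℝ f y e :=
  (hf.fderiv_right (m := (⊤ : ℕ∞)) (by norm_cast)).clm_apply contDiff_const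

theorem lapl_comp_const_sub {f : EuclideanSpace ℝ (Fin n) → ℝ} (hf : ContDiff ℝ (⊤ : ℕ∞) f)
    (x y : EuclideanSpace ℝ (Fin n)) :
    lapl n (fun y => f (x - y)) y = lapl n f (x - y) := by
  refine Finset.sum_congr rfl fun i _ => ?_
  set e : EuclideanSpace ℝ (Fin n) := EuclideanSpace.single i 1
  have h1 : (fun y => fderiv ℝ (fun y => f (x - y)) y e) =
      fun y => (fun z => -fderiv ℝ f z e) (x - y) :=
    funext fun y => fderiv_comp_const_sub_apply (hf.differentiable (by simp)) x y e
  rw [h1, fderiv_comp_const_sub_apply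
    ((contDiff_fderiv_apply hf e).neg.differentiable (by simp)), fderiv_fun_neg]
  simp

theorem hasCompactSupport_fderiv_apply {f : EuclideanSpace ℝ (Fin n) → ℝ}
    (hf : HasCompactSupport f) (e : EuclideanSpace ℝ (Fin n)) :
    HasCompactSupport fun y => fderiv ℝ f y e :=
  (hf.fderiv ℝ).comp_left (g := fun l : EuclideanSpace ℝ (Fin n) →L[ℝ] ℝ => l e) (by simp)

theorem fderiv_convolution_apply {v ρ : EuclideanSpace ℝ (Fin n) → ℝ} (hv : Continuous v)
    (hρ : ContDiff ℝ (⊤ : ℕ∞) ρ) (hρc : HasCompactSupport ρ)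
    (L : ℝ →L[ℝ] ℝ →L[ℝ] ℝ) (x e : EuclideanSpace ℝ (Fin n)) :
    fderiv ℝ (v ⋆[L, volume] ρ) x e = (v ⋆[L, volume] fun y => fderiv ℝ ρ y e) x := by
  have hρ1 : ContDiff ℝ 1 ρ := hρ.of_le (by exact_mod_cast le_top)
  rw [(hρc.hasFDerivAt_convolution_right L hv.locallyIntegrable hρ1 x).fderiv,
    convolution_precompR_apply L hv.locallyIntegrable (hρc.fderiv ℝ)
      (hρ1.continuous_fderiv (by norm_num))]

theorem lapl_convolution_le {v ρ : EuclideanSpace ℝ (Fin n) → ℝ} (hv : Continuous v)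
    (hρ : ContDiff ℝ (⊤ : ℕ∞) ρ) (hρc : HasCompactSupport ρ) (hρ0 : ∀ x, 0 ≤ ρ x)
    (hρ1 : ∫ x, ρ x = 1) {μ : ℝ} (hlap : LapLeWeak n univ v μ) (x : EuclideanSpace ℝ (Fin n)) :
    lapl n (v ⋆[ContinuousLinearMap.mul ℝ ℝ, volume] ρ) x ≤ μ := by
  set M := ContinuousLinearMap.mul ℝ ℝ
  have hterm : ∀ i : Fin n,
      fderiv ℝ (fun y => fderiv ℝ (v ⋆[M, volume] ρ) y (EuclideanSpace.single i 1)) x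
        (EuclideanSpace.single i 1) =
      ∫ y, v y * fderiv ℝ (fun z => fderiv ℝ ρ z (EuclideanSpace.single i 1)) (x - y)
        (EuclideanSpace.single i 1) := by
    intro i
    set e : EuclideanSpace ℝ (Fin n) := EuclideanSpace.single i 1
    have h1 : (fun y => fderiv ℝ (v ⋆[M, volume] ρ) y e) =
        (v ⋆[M, volume] fun y => fderiv ℝ ρ y e) :=
      funext fun y => fderiv_convolution_apply hv hρ hρc M y e
    rw [h1, fderiv_convolution_apply hv (contDiff_fderiv_apply hρ e)
      (hasCompactSupport_fderiv_apply hρc e)]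
    rfl
  have hint : ∀ i ∈ Finset.univ, Integrable fun y => v y *
      fderiv ℝ (fun z => fderiv ℝ ρ z (EuclideanSpace.single i 1)) (x - y)
        (EuclideanSpace.single i (1 : ℝ)) := by
    intro i _
    set e : EuclideanSpace ℝ (Fin n) := EuclideanSpace.single i 1
    exact (hasCompactSupport_fderiv_apply (hasCompactSupport_fderiv_apply hρc e)
      e).convolutionExists_right M hv.locallyIntegrable
      (contDiff_fderiv_apply (contDiff_fderiv_apply hρ e) e).continuous x
  have heq : lapl n (v ⋆[M, volume] ρ) x = ∫ y, v y * lapl n (fun y => ρ (x - y)) y := by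
    simp only [lapl_comp_const_sub hρ]
    simp only [lapl, hterm, Finset.mul_sum]
    rw [integral_finsetSum _ hint]
  have hsupp : HasCompactSupport fun y => ρ (x - y) :=
    hρc.comp_homeomorph (Homeomorph.subLeft x)
  have := hlap (fun y => ρ (x - y)) (hρ.comp (contDiff_const.sub contDiff_id)) hsupp
    (subset_univ _) (fun y => hρ0 _)
  rw [Measure.restrict_univ, integral_sub_left_eq_self ρ volume x, hρ1, mul_one] at this
  rwa [heq]

theorem IsZnPeriodic.convolution {v : EuclideanSpace ℝ (Fin n) → ℝ} (hv : IsZnPeriodic n v)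
    (ρ : EuclideanSpace ℝ (Fin n) → ℝ) (L : ℝ →L[ℝ] ℝ →L[ℝ] ℝ) :
    IsZnPeriodic n (ρ ⋆[L, volume] v) := by
  intro x k
  simp only [convolution_def]
  refine integral_congr_ae (.of_forall fun t => ?_)
  dsimp only
  rw [add_sub_right_comm, hv]

/-- A continuous periodic weak supersolution is approximated on the unit cube by smooth periodic
supersolutions. -/
theorem exists_smooth_supersolution {v : EuclideanSpace ℝ (Fin n) → ℝ} (hv : Continuous v)
    (hper : IsZnPeriodic n v) {μ : ℝ} (hlap : LapLeWeak n univ v μ) {ε : ℝ} (hε : 0 < ε) :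
    ∃ w : EuclideanSpace ℝ (Fin n) → ℝ, ContDiff ℝ 2 w ∧ IsZnPeriodic n w ∧
      (∀ x, lapl n w x ≤ μ) ∧ ∀ x ∈ centredCube n, |w x - v x| ≤ ε := by
  have hu := (isCompact_centredCube n).uniformContinuousAt_of_continuousAt v
    (fun _ _ => hv.continuousAt) (Metric.dist_mem_uniformity hε)
  obtain ⟨δ, hδ, hδ'⟩ := Metric.mem_uniformity_dist.1 hu
  let φ : ContDiffBump (0 : EuclideanSpace ℝ (Fin n)) := ⟨δ / 2, δ, by positivity, by linarith⟩
  set ρ := φ.normed volume with hρ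
  have hρs : ContDiff ℝ (⊤ : ℕ∞) ρ := φ.contDiff_normed
  have hρc : HasCompactSupport ρ := φ.hasCompactSupport_normed
  have hflip : (v ⋆[ContinuousLinearMap.mul ℝ ℝ, volume] ρ) =
      (ρ ⋆[ContinuousLinearMap.lsmul ℝ ℝ, volume] v) := by
    rw [← convolution_flip]
    funext x
    simp only [convolution_def]
    exact integral_congr_ae (.of_forall fun t => by simp [mul_comm])
  refine ⟨v ⋆[ContinuousLinearMap.mul ℝ ℝ, volume] ρ, ?_, ?_, ?_, ?_⟩
  · exact hρc.contDiff_convolution_right (n := 2) _ hv.locallyIntegrable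
      (hρs.of_le (by exact_mod_cast le_top))
  · rw [hflip]
    exact hper.convolution _ _
  · exact lapl_convolution_le hv hρs hρc φ.nonneg_normed φ.integral_normed hlap
  · intro x hx
    rw [hflip, ← Real.dist_eq]
    refine φ.dist_normed_convolution_le hv.aestronglyMeasurable fun y hy => ?_
    have := hδ' (a := x) (b := y) (by rw [dist_comm]; exact hy) hx
    rw [dist_comm]
    exact le_of_lt this

end Mollification

/-- Comparison of a continuous periodic weak supersolution with a radial barrier in the first `m`
coordinates. -/
theorem barrier_le_of_lapLeWeak {n m : ℕ} (hm : 1 ≤ m) (hmn : m ≤ n)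
    {v : EuclideanSpace ℝ (Fin n) → ℝ} (hv : Continuous v) (hper : IsZnPeriodic n v)
    {μ : ℝ} (hμ : 0 < μ) (hlap : LapLeWeak n univ v μ) {H H' H'' : ℝ → ℝ}
    (hH : ∀ t, 0 < t → HasDerivAt H (H' t) t) (hH' : ∀ t, 0 < t → HasDerivAt H' (H'' t) t)
    (hsub : ∀ t, 0 < t → 1 < 4 * t * H'' t + 2 * m * H' t)
    (hanti : AntitoneOn H (Ioc 0 (m : ℝ))) {s : ℝ} (hs : 0 < s) (hs4 : s ≤ 1 / 4) {L : ℝ}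
    (hL : ∀ x, headSq m x ≤ s → -L ≤ v x) (x : EuclideanSpace ℝ (Fin n)) :
    -L - μ * (H s - H m) ≤ v x := by
  refine le_of_forall_pos_le_add fun ε hε => ?_
  obtain ⟨w, hw, hwper, hwlap, hwv⟩ := exists_smooth_supersolution hv hper hlap (half_pos hε)
  have h1 := barrier_le_of_lapl_le hm hmn hw hwper hμ hwlap hH hH' hsub hanti hs hs4
    (L := L + ε / 2) (fun y hy hys => by
      have := (abs_le.1 (hwv y hy)).1
      linarith [hL y hys]) (cubeReduce n x)
  have h2 := (abs_le.1 (hwv (cubeReduce n x) (abs_cubeReduce_le_half x))).2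
  rw [hper.apply_cubeReduce] at h2
  linarith

/-- The barrier estimate with the fundamental solution `Γ` of `ℝᵐ`, written in the variable
`t = |y|²` and normalized by `Γ' = -t^{-m/2}`. -/
theorem laminar_bound_of_fundamental {n m : ℕ} (hm : 1 ≤ m) (hmn : m ≤ n)
    {B : ℝ} (hB : 0 < B) {Ψ : EuclideanSpace ℝ (Fin m) → ℝ}
    (hΨ : ∀ y : EuclideanSpace ℝ (Fin m), ‖y‖ ≤ 1 / 2 → -(B * ‖y‖ ^ 2) ≤ Ψ y)
    {v : EuclideanSpace ℝ (Fin n) → ℝ} (hv : Continuous v) (hper : IsZnPeriodic n v)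
    (hobs : ∀ x, laminar n m hmn Ψ x ≤ v x) {μ : ℝ} (hμ : 0 < μ) (hlap : LapLeWeak n univ v μ)
    {Γ : ℝ → ℝ} (hΓ : ∀ t, 0 < t → HasDerivAt Γ (-t ^ (-(m / 2 : ℝ))) t)
    {s : ℝ} (hs : 0 < s) (hs4 : s ≤ 1 / 4) (x : EuclideanSpace ℝ (Fin n)) :
    -(B * s) - μ * ((m : ℝ) ^ (m / 2 : ℝ) * (Γ s - Γ m) + s) ≤ v x := by
  have hm1 : (1 : ℝ) ≤ m := by exact_mod_cast hm
  set K : ℝ := (m : ℝ) ^ (m / 2 : ℝ) with hK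
  have hH : ∀ t : ℝ, 0 < t →
      HasDerivAt (fun t => K * Γ t + t) (1 - K * t ^ (-(m / 2 : ℝ))) t := fun t ht => by
    convert! ((hΓ t ht).const_mul K).add (hasDerivAt_id t) using 1
    ring
  have hH' : ∀ t : ℝ, 0 < t → HasDerivAt (fun t : ℝ => 1 - K * t ^ (-(m / 2 : ℝ)))
      (K * (m / 2) * t ^ (-(m / 2 : ℝ) - 1)) t := fun t ht => by
    convert! ((Real.hasDerivAt_rpow_const (Or.inl ht.ne')).const_mul K).const_sub 1 using 1
    ring
  have hanti : AntitoneOn (fun t => K * Γ t + t) (Ioc 0 (m : ℝ)) := by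
    refine antitoneOn_of_deriv_nonpos (convex_Ioc _ _)
      (fun t ht => (hH t ht.1).continuousAt.continuousWithinAt)
      (fun t ht => ?_) (fun t ht => ?_) <;> rw [interior_Ioc] at ht
    · exact (hH t ht.1).differentiableAt.differentiableWithinAt
    · rw [(hH t ht.1).deriv, Real.rpow_neg ht.1.le, sub_nonpos, ← div_eq_mul_inv,
        one_le_div (Real.rpow_pos_of_pos ht.1 _)]
      exact Real.rpow_le_rpow ht.1.le ht.2.le (by positivity)
  have key := barrier_le_of_lapLeWeak hm hmn hv hper hμ hlap hH hH' (fun t ht => ?_) hanti hs hs4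
    (L := B * s) (fun y hy => ?_) x
  · refine le_trans ?_ key
    have : 0 ≤ μ * m := by positivity
    linarith
  · have : t * t ^ (-(m / 2 : ℝ) - 1) = t ^ (-(m / 2 : ℝ)) := by
      rw [Real.rpow_sub_one ht.ne']
      field_simp
    calc (1 : ℝ) < 2 * m := by linarith
      _ = 2 * m * K * (t * t ^ (-(m / 2 : ℝ) - 1)) + 2 * m * (1 - K * t ^ (-(m / 2 : ℝ))) := by
        rw [this]; ring
      _ = _ := by ring
  · refine le_trans ?_ (hobs y)
    have hnorm : ‖(WithLp.equiv 2 (Fin m → ℝ)).symm (fun j => y (Fin.castLE hmn j))‖ ^ 2 =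
        headSq m y := by
      rw [EuclideanSpace.norm_sq_eq, headSq, sum_ite_val_lt hmn]
      simp
    refine le_trans ?_ (hΨ _ ?_)
    · rw [hnorm]
      have := mul_le_mul_of_nonneg_left hy hB.le
      linarith
    · refine le_of_sq_le_sq ?_ (by norm_num)
      rw [hnorm]
      linarith

/-- The fundamental solution of `ℝᵖ`, `p ≠ 2`, in the variable `t = |y|²`. -/
theorem hasDerivAt_fundamental {p : ℝ} (hp : p / 2 ≠ 1) {t : ℝ} (ht : 0 < t) :
    HasDerivAt (fun t : ℝ => t ^ (1 - p / 2) / (p / 2 - 1)) (-t ^ (-(p / 2))) t := by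
  convert! (Real.hasDerivAt_rpow_const (p := 1 - p / 2) (Or.inl ht.ne')).div_const (p / 2 - 1)
    using 1
  have : p / 2 - 1 ≠ 0 := sub_ne_zero.2 hp
  rw [show 1 - p / 2 - 1 = -(p / 2) by ring, eq_div_iff this]
  ring

/-- **Corrector height bound for laminar obstacles.**  If `Ψ : ℝ^m → ℝ` is continuous,
`ℤ^m`-periodic, nonpositive, with `Ψ(0) = 0` and `Ψ(y) ≥ -B|y|²` for `|y| ≤ 1/2`, and
`ψ(x) = Ψ(x₁,…,x_m)`, then any continuous `ℤⁿ`-periodic `v ≥ ψ` with `Δv ≤ μ` weakly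
satisfies `v ≥ -Cμ` if `m = 1`, `v ≥ -Cμ(1+|log μ|)` if `m = 2`, and `v ≥ -Cμ^{2/m}`
if `3 ≤ m ≤ n`, with `C = C(n, m, B)`. -/
theorem corrector_bound_laminar (n m : ℕ) (hn : 2 ≤ n) (hm : 1 ≤ m) (hmn : m ≤ n)
    (B : ℝ) (hB : 0 < B) :
    ∃ C > 0, ∀ Ψ : EuclideanSpace ℝ (Fin m) → ℝ,
      Continuous Ψ → IsZnPeriodic m Ψ → (∀ y, Ψ y ≤ 0) → Ψ 0 = 0 →
      (∀ y : EuclideanSpace ℝ (Fin m), ‖y‖ ≤ 1/2 → -(B * ‖y‖ ^ 2) ≤ Ψ y) →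
      ∀ μ ∈ Set.Ioc (0:ℝ) 1, ∀ v : EuclideanSpace ℝ (Fin n) → ℝ,
        Continuous v → IsZnPeriodic n v →
        (∀ x, laminar n m hmn Ψ x ≤ v x) →
        LapLeWeak n Set.univ v μ →
        (m = 1 → ∀ x, -(C * μ) ≤ v x) ∧
        (m = 2 → ∀ x, -(C * μ * (1 + |Real.log μ|)) ≤ v x) ∧
        (3 ≤ m → ∀ x, -(C * μ ^ ((2:ℝ) / m)) ≤ v x) := by
  have hm1 : (1 : ℝ) ≤ m := by exact_mod_cast hm
  set A : ℝ := (m : ℝ) ^ (m / 2 : ℝ) * (2 * (1 / 4 : ℝ) ^ (1 - m / 2 : ℝ)) with hA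
  have hA0 : 0 < A := by positivity
  refine ⟨B + 7 + A, by positivity, ?_⟩
  rintro Ψ - - - - hΨ μ ⟨hμ, hμ1⟩ v hv hper hobs hlap
  have key : ∀ Γ : ℝ → ℝ, (∀ t, 0 < t → HasDerivAt Γ (-t ^ (-(m / 2 : ℝ))) t) →
      ∀ s : ℝ, 0 < s → s ≤ 1 / 4 → ∀ x,
        -(B * s) - μ * ((m : ℝ) ^ (m / 2 : ℝ) * (Γ s - Γ m) + s) ≤ v x :=
    fun Γ hΓ s hs hs4 x => laminar_bound_of_fundamental hm hmn hB hΨ hv hper hobs hμ hlap hΓ hs hs4 x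
  refine ⟨fun h x => ?_, fun h x => ?_, fun h x => ?_⟩
  · have h1 := key _ (fun t ht => hasDerivAt_fundamental (by rw [h]; norm_num) ht) (μ / 4)
      (by positivity) (by linarith) x
    have hmr : (m : ℝ) = 1 := by exact_mod_cast h
    rw [hmr] at h1
    have h2 : 0 ≤ (μ / 4) ^ (1 - 1 / 2 : ℝ) := by positivity
    norm_num at h1 h2
    have h3 : 0 ≤ μ * (μ / 4) ^ (1 / 2 : ℝ) := mul_nonneg hμ.le h2
    have h4 : μ * μ ≤ μ := by nlinarith
    nlinarith [mul_pos hA0 hμ, mul_pos hB hμ]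
  · have h1 := key (fun t => -Real.log t) (fun t ht => by
      rw [h]
      norm_num [Real.rpow_neg_one]
      exact (Real.hasDerivAt_log ht.ne').neg) (μ / 4) (by positivity) (by linarith) x
    have hmr : (m : ℝ) = 2 := by exact_mod_cast h
    rw [hmr] at h1
    have h2 : Real.log (μ / 4) = Real.log μ - 2 * Real.log 2 := by
      rw [Real.log_div hμ.ne' (by norm_num), show (4 : ℝ) = 2 ^ 2 by norm_num, Real.log_pow]
      norm_num
    simp only [h2] at h1
    norm_num at h1
    have h3 : μ * (-Real.log μ + 3 * Real.log 2) ≤ μ * (|Real.log μ| + 3) := by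
      refine mul_le_mul_of_nonneg_left ?_ hμ.le
      linarith [neg_abs_le (Real.log μ), Real.log_two_lt_d9]
    have h4 : μ * μ ≤ μ := by nlinarith
    have h5 : 0 ≤ μ * |Real.log μ| := by positivity
    nlinarith [mul_pos hA0 hμ, mul_pos hB hμ, mul_nonneg hA0.le h5, mul_nonneg hB.le h5]
  · have hm3 : (3 : ℝ) ≤ m := by exact_mod_cast h
    set N : ℝ := μ ^ ((2 : ℝ) / m) with hN
    have hN0 : 0 < N := Real.rpow_pos_of_pos hμ _
    have hN1 : N ≤ 1 := Real.rpow_le_one hμ.le hμ1 (by positivity)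
    have h1 := key _ (fun t ht => hasDerivAt_fundamental (by linarith) ht) (N / 4)
      (by positivity) (by linarith) x
    have h2 : μ * (N / 4) ^ (1 - m / 2 : ℝ) = (1 / 4 : ℝ) ^ (1 - m / 2 : ℝ) * N := by
      have hpow : μ * N ^ (1 - m / 2 : ℝ) = N := by
        rw [hN, ← Real.rpow_mul hμ.le]
        nth_rw 1 [← Real.rpow_one μ]
        rw [← Real.rpow_add hμ]
        congr 1
        field_simp
        ring
      rw [div_eq_mul_one_div, Real.mul_rpow hN0.le (by norm_num), ← mul_assoc, hpow, mul_comm]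
    have h3 : (N / 4) ^ (1 - m / 2 : ℝ) / (m / 2 - 1) - (m : ℝ) ^ (1 - m / 2 : ℝ) / (m / 2 - 1)
        ≤ 2 * (N / 4) ^ (1 - m / 2 : ℝ) := by
      have hp : 0 ≤ (N / 4) ^ (1 - m / 2 : ℝ) := by positivity
      have hq : 0 ≤ (m : ℝ) ^ (1 - m / 2 : ℝ) / (m / 2 - 1) :=
        div_nonneg (by positivity) (by linarith)
      have : (N / 4) ^ (1 - m / 2 : ℝ) / (m / 2 - 1) ≤ 2 * (N / 4) ^ (1 - m / 2 : ℝ) := by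
        rw [div_le_iff₀ (by linarith)]
        nlinarith
      linarith
    have h4 := mul_le_mul_of_nonneg_left h3
      (show 0 ≤ μ * (m : ℝ) ^ (m / 2 : ℝ) by positivity)
    have h5 : μ * (m : ℝ) ^ (m / 2 : ℝ) * (2 * (N / 4) ^ (1 - m / 2 : ℝ)) = A * N := by
      rw [hA]
      linear_combination 2 * (m : ℝ) ^ (m / 2 : ℝ) * h2
    have h6 : μ * N ≤ N := by nlinarith
    have h7 := mul_pos hB hN0
    linarith
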